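/- Let m, n ≥ 1. The algebra Λ^{m|n} of supersymmetric polynomials in ℂ[u_1, …, u_m, v_1, …, v_n] is generated as a ℂ-algebra by the power sums s_p = (u_1^p + ⋯ + u_m^p) − (−1)^p (v_1^p + ⋯ + v_n^p) for p ≥ 1. That is, a polynomial is supersymmetric if and only if it lies in the ℂ-subalgebra generated by { s_p : p ≥ 1 }. -/

import Mathlib

open MvPolynomial

/-- The power sums
`s_p = (u₁^p + ⋯ + u_m^p) − (−1)^p (v₁^p + ⋯ + v_n^p)`
in `ℂ[u₁, …, u_m, v₁, …, v_n]`, with `u_i = X (Sum.inl i)`, `v_j = X (Sum.inr j)`. -/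
noncomputable def powerSum (m n : ℕ) (p : ℕ) : MvPolynomial (Fin m ⊕ Fin n) ℂ :=
  (∑ i : Fin m, X (Sum.inl i) ^ p) -
    (-1 : MvPolynomial (Fin m ⊕ Fin n) ℂ) ^ p * ∑ j : Fin n, X (Sum.inr j) ^ p

/-- The substitution `u_m = t`, `v_n = −t`, leaving all other variables fixed. -/
noncomputable def substVar (m n : ℕ) (t : ℂ) :
    Fin m ⊕ Fin n → MvPolynomial (Fin m ⊕ Fin n) ℂ
  | Sum.inl i => if (i : ℕ) = m - 1 then C t else X (Sum.inl i)
  | Sum.inr j => if (j : ℕ) = n - 1 then C (-t) else X (Sum.inr j)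


namespace SSym

section field
variable {K : Type*} [Field K]

/-- The geometric series. -/
noncomputable def geo (a : K) : PowerSeries K := PowerSeries.mk fun p => a ^ p

/-- The linear factor `1 - a x`. -/
noncomputable def lin (a : K) : PowerSeries K := 1 - PowerSeries.C a * PowerSeries.X

lemma lin_mul_geo (a : K) : lin a * geo a = 1 := by
  ext k
  cases k with
  | zero => simp [lin, geo, sub_mul, mul_assoc]
  | succ k =>
    simp [lin, geo, sub_mul, mul_assoc, PowerSeries.coeff_succ_X_mul, PowerSeries.coeff_one,
      pow_succ']

/-- The derivative of F is minus S times F. -/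
def LogD (F S : PowerSeries K) : Prop := PowerSeries.derivative K F = - (S * F)

lemma LogD.one : LogD (1 : PowerSeries K) 0 := by
  simp [LogD]

lemma LogD.mul {F G S T : PowerSeries K} (h : LogD F S) (h' : LogD G T) :
    LogD (F * G) (S + T) := by
  unfold LogD at *
  rw [Derivation.leibniz, h, h']
  simp only [smul_eq_mul]
  ring

lemma LogD.lin (a : K) : LogD (lin a) (PowerSeries.C a * geo a) := by
  unfold LogD
  rw [mul_assoc, mul_comm (geo a), lin_mul_geo]
  simp [SSym.lin, Derivation.leibniz]

lemma LogD.geo (a : K) : LogD (geo a) (-(PowerSeries.C a * geo a)) := by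
  have h := congrArg (PowerSeries.derivative K) (lin_mul_geo a)
  rw [Derivation.leibniz, LogD.lin a] at h
  simp only [smul_eq_mul, Derivation.map_one_eq_zero] at h
  unfold LogD
  have h1 := lin_mul_geo a
  set G := SSym.geo a
  set l := SSym.lin a
  set D := PowerSeries.derivative K G
  set c := PowerSeries.C a
  linear_combination G * h - (D - G^2 * c) * h1

lemma LogD.prod {ι : Type*} (s : Finset ι) (F S : ι → PowerSeries K)
    (h : ∀ i ∈ s, LogD (F i) (S i)) : LogD (∏ i ∈ s, F i) (∑ i ∈ s, S i) := by
  classical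
  induction s using Finset.induction_on with
  | empty => simpa using LogD.one
  | insert a s ha ih =>
    rw [Finset.prod_insert ha, Finset.sum_insert ha]
    exact (h a (by simp)).mul (ih fun i hi => h i (by simp [hi]))

variable [Algebra ℂ K] {m n : ℕ}

/-- The generating series. -/
noncomputable def gen (u : Fin m → K) (v : Fin n → K) : PowerSeries K :=
  (∏ i, lin (u i)) * ∏ j, geo (v j)

lemma coeff_gen_mem (u : Fin m → K) (v : Fin n → K) (A : Subalgebra ℂ K)
    (hA : ∀ p, 1 ≤ p → (∑ i, u i ^ p - ∑ j, v j ^ p) ∈ A) (k : ℕ) :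
    PowerSeries.coeff k (gen u v) ∈ A := by
  have hD : LogD (gen u v) _ :=
    (LogD.prod Finset.univ (fun i => lin (u i)) _ fun i _ => LogD.lin (u i)).mul
      (LogD.prod Finset.univ (fun j => geo (v j)) _ fun j _ => LogD.geo (v j))
  set S := ∑ i, PowerSeries.C (u i) * geo (u i) + ∑ j, -(PowerSeries.C (v j) * geo (v j)) with hS
  have hSA : ∀ p, PowerSeries.coeff p S ∈ A := by
    intro p
    convert hA (p+1) (by omega) using 1
    simp [hS, geo, pow_succ', sub_eq_add_neg]
  induction k using Nat.strong_induction_on with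
  | _ k ih =>
    cases k with
    | zero =>
      have : PowerSeries.coeff 0 (gen u v) = 1 := by
        simp [gen, lin, geo, map_prod]
      rw [this]; exact A.one_mem
    | succ k =>
      have h := congrArg (PowerSeries.coeff k) hD
      rw [PowerSeries.coeff_derivative, map_neg, PowerSeries.coeff_mul] at h
      have h2 : PowerSeries.coeff (k+1) (gen u v) =
          ((k+1 : ℂ)⁻¹) • (- ∑ q ∈ Finset.HasAntidiagonal.antidiagonal k, PowerSeries.coeff q.1 S *
            PowerSeries.coeff q.2 (gen u v)) := by
        rw [← h, Algebra.smul_def, mul_left_comm]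
        have : (k + 1 : K) = algebraMap ℂ K (k+1) := by simp
        rw [this, ← map_mul, inv_mul_cancel₀ (by exact_mod_cast Nat.succ_ne_zero k)]
        simp
      rw [h2]
      refine A.smul_mem (A.neg_mem (A.sum_mem fun q hq => A.mul_mem (hSA _) (ih _ ?_))) _
      have := Finset.HasAntidiagonal.mem_antidiagonal.1 hq
      omega

/-- The residue functional. -/
noncomputable def res (v : Fin n → K) (P : Polynomial K) : K :=
  ∑ j, P.eval (v j) / ∏ i ∈ Finset.univ.erase j, (v j - v i)

/-- Its generating series. -/
noncomputable def resSeries (v : Fin n → K) : PowerSeries K :=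
  PowerSeries.mk fun k => res v (Polynomial.X ^ k)

lemma res_sub (v : Fin n → K) (P Q : Polynomial K) : res v (P - Q) = res v P - res v Q := by
  simp [res, sub_div]

lemma res_C_mul (v : Fin n → K) (a : K) (P : Polynomial K) :
    res v (Polynomial.C a * P) = a * res v P := by
  simp [res, Finset.mul_sum, mul_div_assoc]

lemma coeff_lin_mul (a : K) (G : PowerSeries K) (k : ℕ) :
    PowerSeries.coeff (k+1) (lin a * G) = PowerSeries.coeff (k+1) G - a * PowerSeries.coeff k G := by
  simp [lin, sub_mul, mul_assoc, PowerSeries.coeff_succ_X_mul]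

lemma coeff_lin_resSeries {ι : Type*} (v : Fin n → K) (s : Finset ι) (u : ι → K) (k : ℕ) :
    PowerSeries.coeff (k + s.card) ((∏ i ∈ s, lin (u i)) * resSeries v) =
      res v ((∏ i ∈ s, (Polynomial.X - Polynomial.C (u i))) * Polynomial.X ^ k) := by
  classical
  induction s using Finset.induction_on generalizing k with
  | empty => simp [resSeries]
  | insert a s ha ih =>
    rw [Finset.prod_insert ha, Finset.prod_insert ha, Finset.card_insert_of_notMem ha,
      ← add_assoc, mul_assoc, coeff_lin_mul, ih, add_right_comm, ih, ← res_C_mul, ← res_sub]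
    congr 1
    ring

lemma lin_mul_resSeries (v : Fin (n+1) → K) (hv : Function.Injective v) :
    (∏ j, lin (v j)) * resSeries v = PowerSeries.X ^ n := by
  have key : ∀ k ≤ n, res v (Polynomial.X ^ k) = if k = n then 1 else 0 := by
    intro k hk
    have := Lagrange.coeff_eq_sum (s := Finset.univ) (v := v) hv.injOn (P := Polynomial.X ^ k)
      (by rw [Polynomial.degree_X_pow]; simp; exact_mod_cast Nat.lt_succ_of_le hk)
    unfold res
    rw [← this]
    simp [Polynomial.coeff_X_pow, eq_comm]
  obtain ⟨H, hH⟩ : PowerSeries.X ^ n ∣ resSeries v := by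
    rw [PowerSeries.X_pow_dvd_iff]
    intro k hk
    simp [resSeries, key k hk.le, hk.ne]
  have hH0 : PowerSeries.constantCoeff H = 1 := by
    have := congrArg (PowerSeries.coeff n) hH
    simpa [resSeries, key n le_rfl, PowerSeries.coeff_X_pow_mul'] using this.symm
  ext k
  rcases Nat.lt_or_ge n k with hk | hk
  · obtain ⟨l, rfl⟩ := Nat.exists_eq_add_of_lt hk
    have := coeff_lin_resSeries v Finset.univ v l
    rw [Finset.card_fin] at this
    rw [show n + l + 1 = l + (n + 1) by ring, this, PowerSeries.coeff_X_pow, if_neg (by omega)]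
    unfold res
    refine Finset.sum_eq_zero fun j _ => ?_
    rw [Polynomial.eval_mul, Polynomial.eval_prod, Finset.prod_eq_zero (Finset.mem_univ j)]
    · simp
    · simp
  · rw [hH, mul_left_comm, PowerSeries.coeff_X_pow_mul', PowerSeries.coeff_X_pow]
    rcases hk.lt_or_eq with h | rfl
    · rw [if_neg (by omega), if_neg (by omega)]
    · simp [hH0, lin, map_prod]

lemma res_mem (u : Fin m → K) (v : Fin n → K) (hv : Function.Injective v) (A : Subalgebra ℂ K)
    (hA : ∀ p, 1 ≤ p → (∑ i, u i ^ p - ∑ j, v j ^ p) ∈ A) (k : ℕ) :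
    res v ((∏ i, (Polynomial.X - Polynomial.C (u i))) * Polynomial.X ^ k) ∈ A := by
  cases n with
  | zero => simp [res]
  | succ n =>
    rw [← coeff_lin_resSeries]
    have : (∏ i, lin (u i)) * resSeries v = PowerSeries.X ^ n * gen u v := by
      rw [← lin_mul_resSeries v hv, gen]
      have : (∏ j, lin (v j)) * ∏ j, geo (v j) = 1 := by
        rw [← Finset.prod_mul_distrib]
        exact Finset.prod_eq_one fun j _ => lin_mul_geo _
      linear_combination (- (∏ i, lin (u i)) * resSeries v) * this
    rw [this, PowerSeries.coeff_X_pow_mul']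
    split_ifs
    · exact coeff_gen_mem u v A hA _
    · exact A.zero_mem

lemma prod_offdiag (v : Fin n → K) : ∃ e : ℤˣ,
    ∏ j, ∏ i ∈ Finset.univ.erase j, (v j - v i) =
      ((e : ℤ) : K) * (Matrix.vandermonde v).det ^ 2 := by
  have h := Finset.prod_prod_Ioi_mul_eq_prod_prod_off_diag (fun i j : Fin n => v i - v j)
  refine ⟨∏ i : Fin n, ∏ j ∈ Finset.Ioi i, (-1), ?_⟩
  have e1 : ∀ j : Fin n, Finset.univ.erase j = ({j} : Finset (Fin n))ᶜ := by
    intro j; ext; simp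
  have h2 : ∏ j, ∏ i ∈ Finset.univ.erase j, (v j - v i) = 
     ∏ i, ∏ j ∈ Finset.univ.erase i, (v j - v i) := by
     refine Finset.prod_comm' ?_
     intro x y; simp [eq_comm]
  simp_rw [h2, e1]
  rw [← h, Matrix.det_vandermonde]
  push_cast
  rw [pow_two, ← Finset.prod_mul_distrib, ← Finset.prod_mul_distrib]
  refine Finset.prod_congr rfl fun i _ => ?_
  rw [← Finset.prod_mul_distrib, ← Finset.prod_mul_distrib]
  refine Finset.prod_congr rfl fun j _ => ?_
  ring

lemma alternant_mem (u : Fin m → K) (v : Fin n → K) (hv : Function.Injective v)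
    (A : Subalgebra ℂ K)
    (hA : ∀ p, 1 ≤ p → (∑ i, u i ^ p - ∑ j, v j ^ p) ∈ A) (α : Fin n → ℕ) :
    ∃ a ∈ A, (∏ j, ∏ i, (v j - u i)) * (Matrix.of fun a j => v j ^ α a).det =
      (Matrix.vandermonde v).det * a := by
  set U : Polynomial K := ∏ i, (Polynomial.X - Polynomial.C (u i)) with hU
  have hUe : ∀ x, U.eval x = ∏ i, (x - u i) := by
    intro x; simp [hU, Polynomial.eval_prod]
  let M : Matrix (Fin n) (Fin n) K := Matrix.of fun a b => res v (U * Polynomial.X ^ (α a + b))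
  let d : Fin n → K := fun j => U.eval (v j) / ∏ i ∈ Finset.univ.erase j, (v j - v i)
  have hM : M = (Matrix.of fun a j => v j ^ α a) * Matrix.diagonal d * Matrix.vandermonde v := by
    ext a b
    rw [Matrix.mul_apply]
    simp only [M, Matrix.of_apply, res, Matrix.mul_diagonal, Matrix.vandermonde_apply, d]
    refine Finset.sum_congr rfl fun j _ => ?_
    simp [pow_add]; ring
  have hMA : M.det ∈ A := by
    rw [Matrix.det_apply]
    refine A.sum_mem fun σ _ => ?_
    rw [Units.smul_def]
    refine A.toSubring.zsmul_mem (A.prod_mem fun i _ => ?_) _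
    exact res_mem u v hv A hA _
  obtain ⟨e, he⟩ := prod_offdiag v
  have hvand : (Matrix.vandermonde v).det ≠ 0 := Matrix.det_vandermonde_ne_zero_iff.2 hv
  refine ⟨((e : ℤ) : K) * M.det, A.mul_mem (A.intCast_mem _) hMA, ?_⟩
  have hee : ((e : ℤ) : K) * ((e : ℤ) : K) = 1 := by
    rcases Int.units_eq_one_or e with h | h <;> simp [h]
  have hne : ((e : ℤ) : K) ≠ 0 := left_ne_zero_of_mul_eq_one hee
  rw [hM, Matrix.det_mul, Matrix.det_mul, Matrix.det_diagonal]
  simp only [d, Finset.prod_div_distrib]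
  rw [he]
  simp_rw [hUe]
  field_simp

lemma antisymm_mem (u : Fin m → K) (v : Fin n → K) (hv : Function.Injective v)
    (A : Subalgebra ℂ K)
    (hA : ∀ p, 1 ≤ p → (∑ i, u i ^ p - ∑ j, v j ^ p) ∈ A) (F : MvPolynomial (Fin n) ℂ) :
    ∃ a ∈ A, (∏ j, ∏ i, (v j - u i)) *
      (∑ σ : Equiv.Perm (Fin n), ((Equiv.Perm.sign σ : ℤ) : K) * aeval (v ∘ σ) F) =
      (Matrix.vandermonde v).det * a := by
  induction F using MvPolynomial.induction_on' with
  | monomial α c =>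
    obtain ⟨a, ha, h⟩ := alternant_mem u v hv A hA α
    refine ⟨c • a, A.smul_mem ha c, ?_⟩
    rw [mul_smul_comm, ← h, ← mul_smul_comm, ← Matrix.det_transpose, Matrix.det_apply,
      Finset.smul_sum]
    congr 1
    refine Finset.sum_congr rfl fun σ _ => ?_
    rw [aeval_monomial, Finsupp.prod_fintype _ _ (by simp), Algebra.smul_def, Units.smul_def,
      zsmul_eq_mul]
    simp
    ring
  | add p q hp hq =>
    obtain ⟨a, ha, h⟩ := hp
    obtain ⟨b, hb, h'⟩ := hq
    refine ⟨a + b, A.add_mem ha hb, ?_⟩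
    rw [mul_add, ← h, ← h', ← mul_add, ← Finset.sum_add_distrib]
    simp [mul_add]

lemma sym_mem (u : Fin m → K) (v : Fin n → K) (hv : Function.Injective v)
    (A : Subalgebra ℂ K)
    (hA : ∀ p, 1 ≤ p → (∑ i, u i ^ p - ∑ j, v j ^ p) ∈ A) (h : MvPolynomial (Fin n) ℂ)
    (hh : h.IsSymmetric) :
    (∏ j, ∏ i, (v j - u i)) * aeval v h ∈ A := by
  obtain ⟨a, ha, e⟩ := antisymm_mem u v hv A hA
    ((Matrix.vandermonde (X : Fin n → MvPolynomial (Fin n) ℂ)).det * h)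
  have hvand : (Matrix.vandermonde v).det ≠ 0 := Matrix.det_vandermonde_ne_zero_iff.2 hv
  have h1 : ∀ σ : Equiv.Perm (Fin n), aeval (v ∘ σ) h = aeval v h := by
    intro σ
    conv_rhs => rw [← hh σ, aeval_rename]
  have h2 : ∀ σ : Equiv.Perm (Fin n),
      aeval (v ∘ σ) (Matrix.vandermonde (X : Fin n → MvPolynomial (Fin n) ℂ)).det =
        ((Equiv.Perm.sign σ : ℤ) : K) * (Matrix.vandermonde v).det := by
    intro σ
    rw [← Matrix.det_permute, AlgHom.map_det]
    congr 1
    ext i j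
    simp [Matrix.vandermonde_apply]
  have h3 : ∀ σ : Equiv.Perm (Fin n), ((Equiv.Perm.sign σ : ℤ) : K) *
      aeval (v ∘ σ) ((Matrix.vandermonde (X : Fin n → MvPolynomial (Fin n) ℂ)).det * h) =
      (Matrix.vandermonde v).det * aeval v h := by
    intro σ
    rw [map_mul, h1, h2]
    rcases Int.units_eq_one_or (Equiv.Perm.sign σ) with h | h <;> simp [h]
  simp_rw [h3] at e
  rw [Finset.sum_const, nsmul_eq_mul, Finset.card_univ, Fintype.card_perm, Fintype.card_fin] at e
  have hf : ((n.factorial : ℕ) : ℂ) ≠ 0 := by exact_mod_cast n.factorial_ne_zero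
  have : (∏ j, ∏ i, (v j - u i)) * aeval v h = ((n.factorial : ℕ) : ℂ)⁻¹ • a := by
    rw [eq_inv_smul_iff₀ hf, Algebra.smul_def, map_natCast]
    apply mul_left_cancel₀ hvand
    linear_combination e
  rw [this]
  exact A.smul_mem ha _

end field
end SSym

namespace SSym

lemma esymm_mem_adjoin (n k : ℕ) : esymm (Fin n) ℂ k ∈
    Algebra.adjoin ℂ {g | ∃ p : ℕ, 1 ≤ p ∧ g = psum (Fin n) ℂ p} := by
  induction k using Nat.strong_induction_on with
  | _ k ih =>
    rcases Nat.eq_zero_or_pos k with rfl | hk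
    · simp [Subalgebra.one_mem]
    have h := mul_esymm_eq_sum (Fin n) ℂ k
    have hk' : (k : ℂ) ≠ 0 := by exact_mod_cast hk.ne'
    have h2 : esymm (Fin n) ℂ k = (k : ℂ)⁻¹ • ((k : MvPolynomial (Fin n) ℂ) * esymm (Fin n) ℂ k) := by
      rw [eq_inv_smul_iff₀ hk', Algebra.smul_def, map_natCast]
    rw [h2, h]
    refine Subalgebra.smul_mem _ (Subalgebra.mul_mem _ ?_ (Subalgebra.sum_mem _ fun a ha => ?_)) _
    · exact Subalgebra.pow_mem _ (Subalgebra.neg_mem _ (Subalgebra.one_mem _)) _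
    · rw [Finset.mem_filter, Finset.HasAntidiagonal.mem_antidiagonal] at ha
      refine Subalgebra.mul_mem _ (Subalgebra.mul_mem _ ?_ (ih _ ha.2)) ?_
      · exact Subalgebra.pow_mem _ (Subalgebra.neg_mem _ (Subalgebra.one_mem _)) _
      · exact Algebra.subset_adjoin ⟨a.2, by omega, rfl⟩

lemma sym_mem_adjoin (n : ℕ) (h : MvPolynomial (Fin n) ℂ) (hh : h.IsSymmetric) : h ∈
    Algebra.adjoin ℂ {g | ∃ p : ℕ, 1 ≤ p ∧ g = psum (Fin n) ℂ p} := by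
  obtain ⟨q, hq⟩ := esymmAlgHom_surjective ℂ (σ := Fin n) (n := n) (by simp) ⟨h, hh⟩
  have hq' : (symmetricSubalgebra (Fin n) ℂ).val (esymmAlgHom (Fin n) ℂ n q) = h := by
    rw [hq]; rfl
  rw [← hq']
  clear hq hq'
  induction q using MvPolynomial.induction_on with
  | C a =>
    rw [← algebraMap_eq, AlgHom.commutes, AlgHom.commutes]
    exact Subalgebra.algebraMap_mem _ _
  | add p q hp hq => rw [map_add, map_add]; exact Subalgebra.add_mem _ hp hq
  | mul_X p i hp =>
    rw [map_mul, map_mul]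
    refine Subalgebra.mul_mem _ hp ?_
    simp only [esymmAlgHom, aeval_X]
    exact esymm_mem_adjoin n (i + 1)

variable {m n : ℕ}

/-- The algebra generated by the power sums. -/
noncomputable abbrev PA (m n : ℕ) : Subalgebra ℂ (MvPolynomial (Fin m ⊕ Fin n) ℂ) :=
  Algebra.adjoin ℂ {g : MvPolynomial (Fin m ⊕ Fin n) ℂ | ∃ p : ℕ, 1 ≤ p ∧ g = powerSum m n p}

/-- The product of all `-v_j - u_i`. -/
noncomputable def Del (m n : ℕ) : MvPolynomial (Fin m ⊕ Fin n) ℂ :=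
  ∏ j : Fin n, ∏ i : Fin m, (-X (Sum.inr j) - X (Sum.inl i))

/-- Symmetric polynomials in `-v`. -/
noncomputable def SB (m n : ℕ) : Subalgebra ℂ (MvPolynomial (Fin m ⊕ Fin n) ℂ) :=
  (symmetricSubalgebra (Fin n) ℂ).map (aeval (fun j => -X (Sum.inr j)))

lemma powerSum_eq (p : ℕ) : powerSum m n p =
    ∑ i : Fin m, X (Sum.inl i) ^ p - ∑ j : Fin n, (-X (Sum.inr j)) ^ p := by
  simp_rw [powerSum, neg_pow (X (Sum.inr _) : MvPolynomial (Fin m ⊕ Fin n) ℂ), Finset.mul_sum]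

lemma Del_mul_SB (b : MvPolynomial (Fin m ⊕ Fin n) ℂ) (hb : b ∈ SB m n) :
    Del m n * b ∈ PA m n := by
  obtain ⟨h, hh, rfl⟩ := hb
  let φ : MvPolynomial (Fin m ⊕ Fin n) ℂ →ₐ[ℂ] FractionRing (MvPolynomial (Fin m ⊕ Fin n) ℂ) :=
    IsScalarTower.toAlgHom _ _ _
  have hφ : Function.Injective φ := IsFractionRing.injective _ _
  have key := sym_mem (fun i : Fin m => φ (X (Sum.inl i))) (fun j : Fin n => φ (-X (Sum.inr j)))
    (by
      intro a b hab
      have := neg_injective (hφ hab)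
      exact Sum.inr_injective (X_injective this))
    ((PA m n).map φ) (by
      intro p hp
      refine ⟨powerSum m n p, Algebra.subset_adjoin ⟨p, hp, rfl⟩, ?_⟩
      change φ _ = _
      rw [powerSum_eq]
      simp only [map_sub, map_sum, map_pow]) h hh
  obtain ⟨a, ha, e⟩ := key
  suffices hs : a = Del m n * aeval (fun j => -X (Sum.inr j)) h by
    rw [hs] at ha
    exact ha
  apply hφ
  refine Eq.trans e ?_
  rw [map_mul, Del]
  simp only [map_prod, map_sub]
  congr 1
  have := comp_aeval_apply (fun j : Fin n => (-X (Sum.inr j) : MvPolynomial (Fin m ⊕ Fin n) ℂ)) φ h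
  exact this.symm

lemma Del_mul_sup (b : MvPolynomial (Fin m ⊕ Fin n) ℂ) (hb : b ∈ PA m n ⊔ SB m n) :
    Del m n * b ∈ PA m n := by
  rw [← Subalgebra.mem_toSubmodule, ← Subalgebra.mul_toSubmodule] at hb
  induction hb using Submodule.mul_induction_on' with
  | mem_mul_mem a ha b hb =>
    rw [mul_left_comm]
    exact Subalgebra.mul_mem _ ha (Del_mul_SB b hb)
  | add x hx y hy h1 h2 => rw [mul_add]; exact Subalgebra.add_mem _ h1 h2

lemma psum_inr_mem (p : ℕ) : ∑ j : Fin n, (-X (Sum.inr j)) ^ p ∈ SB m n :=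
  ⟨psum (Fin n) ℂ p, psum_isSymmetric _ _ _, by simp [psum]⟩

lemma inl_mem (h : MvPolynomial (Fin m) ℂ) (hh : h.IsSymmetric) :
    rename Sum.inl h ∈ PA m n ⊔ SB m n := by
  have := sym_mem_adjoin m h hh
  suffices Algebra.adjoin ℂ {g | ∃ p : ℕ, 1 ≤ p ∧ g = psum (Fin m) ℂ p} ≤
    (PA m n ⊔ SB m n).comap (rename Sum.inl) from this ‹_›
  refine Algebra.adjoin_le ?_
  rintro _ ⟨p, hp, rfl⟩
  change rename Sum.inl _ ∈ PA m n ⊔ SB m n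
  have : rename Sum.inl (psum (Fin m) ℂ p) = powerSum m n p + ∑ j : Fin n, (-X (Sum.inr j)) ^ p := by
    simp [powerSum_eq, psum]
  rw [this]
  exact Subalgebra.add_mem _ (Algebra.mem_sup_left (Algebra.subset_adjoin ⟨p, hp, rfl⟩))
    (Algebra.mem_sup_right (psum_inr_mem p))

lemma inr_mem (h : MvPolynomial (Fin n) ℂ) (hh : h.IsSymmetric) :
    rename Sum.inr h ∈ PA m n ⊔ SB m n := by
  have := sym_mem_adjoin n h hh
  suffices Algebra.adjoin ℂ {g | ∃ p : ℕ, 1 ≤ p ∧ g = psum (Fin n) ℂ p} ≤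
    (PA m n ⊔ SB m n).comap (rename Sum.inr) from this ‹_›
  refine Algebra.adjoin_le ?_
  rintro _ ⟨p, hp, rfl⟩
  change rename Sum.inr _ ∈ PA m n ⊔ SB m n
  have : rename Sum.inr (psum (Fin n) ℂ p) =
      (-1 : MvPolynomial (Fin m ⊕ Fin n) ℂ) ^ p * ∑ j : Fin n, (-X (Sum.inr j)) ^ p := by
    simp_rw [neg_pow (X (Sum.inr _) : MvPolynomial (Fin m ⊕ Fin n) ℂ), ← Finset.mul_sum, ← mul_assoc, ← mul_pow]
    simp [psum]
  rw [this]
  exact Subalgebra.mul_mem _ (Subalgebra.pow_mem _ (Subalgebra.neg_mem _ (Subalgebra.one_mem _)) _)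
    (Algebra.mem_sup_right (psum_inr_mem p))

lemma symmetrize_isSymmetric {k : ℕ} (F : MvPolynomial (Fin k) ℂ) :
    (∑ σ : Equiv.Perm (Fin k), rename σ F).IsSymmetric := by
  intro e
  rw [map_sum]
  simp_rw [rename_rename]
  exact Fintype.sum_equiv (Equiv.mulLeft e) _ _ fun σ => rfl

lemma dsymmetrize_mem (F : MvPolynomial (Fin m ⊕ Fin n) ℂ) :
    ∑ σ : Equiv.Perm (Fin m), ∑ τ : Equiv.Perm (Fin n), rename (Sum.map σ τ) F ∈
      PA m n ⊔ SB m n := by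
  induction F using MvPolynomial.induction_on' with
  | monomial s c =>
    let a : MvPolynomial (Fin m) ℂ := ∏ i, X i ^ s (Sum.inl i)
    let b : MvPolynomial (Fin n) ℂ := ∏ i, X i ^ s (Sum.inr i)
    have : ∑ σ : Equiv.Perm (Fin m), ∑ τ : Equiv.Perm (Fin n),
        rename (Sum.map σ τ) (monomial s c) =
        c • (rename Sum.inl (∑ σ : Equiv.Perm (Fin m), rename σ a) *
          rename Sum.inr (∑ σ : Equiv.Perm (Fin n), rename σ b)) := by
      rw [map_sum, map_sum, Finset.sum_mul_sum, Finset.smul_sum]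
      refine Finset.sum_congr rfl fun σ _ => ?_
      rw [Finset.smul_sum]
      refine Finset.sum_congr rfl fun τ _ => ?_
      rw [monomial_eq, Finsupp.prod_fintype _ _ (by simp), Fintype.prod_sum_type, smul_eq_C_mul]
      simp [a, b]
    rw [this]
    exact Subalgebra.smul_mem _ (Subalgebra.mul_mem _ (inl_mem _ (symmetrize_isSymmetric a))
      (inr_mem _ (symmetrize_isSymmetric b))) _
  | add p q hp hq =>
    simp_rw [map_add, Finset.sum_add_distrib]
    exact Subalgebra.add_mem _ hp hq

lemma Del_mul_mem (q : MvPolynomial (Fin m ⊕ Fin n) ℂ)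
    (hq : ∀ (σ : Equiv.Perm (Fin m)) (τ : Equiv.Perm (Fin n)), rename (Sum.map σ τ) q = q) :
    Del m n * q ∈ PA m n := by
  apply Del_mul_sup
  have h := dsymmetrize_mem q
  simp_rw [hq] at h
  rw [Finset.sum_const, Finset.sum_const, ← mul_nsmul, Finset.card_univ, Finset.card_univ,
    ← Nat.cast_smul_eq_nsmul ℂ] at h
  have h2 := Subalgebra.smul_mem _ h
    ((Fintype.card (Equiv.Perm (Fin n)) * Fintype.card (Equiv.Perm (Fin m)) : ℕ) : ℂ)⁻¹
  rwa [inv_smul_smul₀] at h2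
  have := mul_ne_zero (Fintype.card_ne_zero (α := Equiv.Perm (Fin n)))
    (Fintype.card_ne_zero (α := Equiv.Perm (Fin m)))
  exact_mod_cast this

/-- Supersymmetry, in terms of evaluations. -/
structure SS (f : MvPolynomial (Fin m ⊕ Fin n) ℂ) : Prop where
  symm : ∀ (σ : Equiv.Perm (Fin m)) (τ : Equiv.Perm (Fin n)) (u : Fin m → ℂ) (v : Fin n → ℂ),
    eval (Sum.elim (u ∘ σ) (v ∘ τ)) f = eval (Sum.elim u v) f
  canc : ∀ (i : Fin m) (j : Fin n) (u : Fin m → ℂ) (v : Fin n → ℂ) (t t' : ℂ),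
    eval (Sum.elim (Function.update u i t) (Function.update v j (-t))) f =
    eval (Sum.elim (Function.update u i t') (Function.update v j (-t'))) f

lemma SS.sub {f g : MvPolynomial (Fin m ⊕ Fin n) ℂ} (hf : SS f) (hg : SS g) : SS (f - g) where
  symm σ τ u v := by rw [map_sub, map_sub, hf.symm, hg.symm]
  canc i j u v t t' := by rw [map_sub, map_sub, hf.canc i j u v t t', hg.canc i j u v t t']

lemma SS_powerSum (p : ℕ) : SS (powerSum m n p) where
  symm σ τ u v := by
    simp only [powerSum_eq, map_sub, map_sum, map_pow, map_neg, eval_X, Sum.elim_inl, Sum.elim_inr,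
      Function.comp_apply]
    rw [Equiv.sum_comp σ (fun i => u i ^ p), Equiv.sum_comp τ (fun i => (-v i) ^ p)]
  canc i j u v t t' := by
    simp only [powerSum_eq, map_sub, map_sum, map_pow, map_neg, eval_X, Sum.elim_inl, Sum.elim_inr]
    have key : ∀ (t : ℂ), ∑ x, Function.update u i t x ^ p -
        ∑ x, (-Function.update v j (-t) x) ^ p =
        ∑ x ∈ Finset.univ.erase i, u x ^ p - ∑ x ∈ Finset.univ.erase j, (-v x) ^ p := by
      intro t
      rw [← Finset.add_sum_erase _ _ (Finset.mem_univ i),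
        ← Finset.add_sum_erase _ _ (Finset.mem_univ j)]
      have h1 : ∑ x ∈ Finset.univ.erase i, Function.update u i t x ^ p =
          ∑ x ∈ Finset.univ.erase i, u x ^ p :=
        Finset.sum_congr rfl fun x hx => by
          rw [Function.update_of_ne (Finset.ne_of_mem_erase hx)]
      have h2 : ∑ x ∈ Finset.univ.erase j, (-Function.update v j (-t) x) ^ p =
          ∑ x ∈ Finset.univ.erase j, (-v x) ^ p :=
        Finset.sum_congr rfl fun x hx => by
          rw [Function.update_of_ne (Finset.ne_of_mem_erase hx)]
      rw [h1, h2]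
      simp
    rw [key, key]

lemma SS_of_mem {f : MvPolynomial (Fin m ⊕ Fin n) ℂ} (hf : f ∈ PA m n) : SS f := by
  induction hf using Algebra.adjoin_induction with
  | mem x hx => obtain ⟨p, _, rfl⟩ := hx; exact SS_powerSum p
  | algebraMap r => exact ⟨fun _ _ _ _ => by rw [algebraMap_eq, eval_C, eval_C],
      fun _ _ _ _ _ _ => by rw [algebraMap_eq, eval_C, eval_C]⟩
  | add f g _ _ hf hg =>
    exact ⟨fun σ τ u v => by rw [map_add, map_add, hf.symm, hg.symm],
      fun i j u v t t' => by rw [map_add, map_add, hf.canc i j u v t t', hg.canc i j u v t t']⟩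
  | mul f g _ _ hf hg =>
    exact ⟨fun σ τ u v => by rw [map_mul, map_mul, hf.symm, hg.symm],
      fun i j u v t t' => by rw [map_mul, map_mul, hf.canc i j u v t t', hg.canc i j u v t t']⟩

lemma SS.rename_eq {f : MvPolynomial (Fin m ⊕ Fin n) ℂ} (hf : SS f)
    (σ : Equiv.Perm (Fin m)) (τ : Equiv.Perm (Fin n)) : rename (Sum.map σ τ) f = f := by
  apply MvPolynomial.funext
  intro x
  rw [eval_rename]
  have := hf.symm σ τ (x ∘ Sum.inl) (x ∘ Sum.inr)
  rw [Sum.elim_comp_inl_inr] at this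
  rw [← this]
  congr 2
  ext i
  cases i <;> simp

/-- Setting `u_0 = v_0 = 0`. -/
noncomputable def pi0 (m n : ℕ) : MvPolynomial (Fin (m+1) ⊕ Fin (n+1)) ℂ →ₐ[ℂ]
    MvPolynomial (Fin m ⊕ Fin n) ℂ :=
  aeval (Sum.elim (Fin.cons 0 fun i => X (Sum.inl i)) (Fin.cons 0 fun j => X (Sum.inr j)))

lemma eval_pi0 (u : Fin m → ℂ) (v : Fin n → ℂ) (f : MvPolynomial (Fin (m+1) ⊕ Fin (n+1)) ℂ) :
    eval (Sum.elim u v) (pi0 m n f) =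
      eval (Sum.elim (Fin.cons 0 u : Fin (m+1) → ℂ) (Fin.cons 0 v : Fin (n+1) → ℂ)) f := by
  induction f using MvPolynomial.induction_on with
  | C a => simp [pi0]
  | add p q hp hq => simp [hp, hq]
  | mul_X p i hp =>
    rw [map_mul, map_mul, map_mul, hp]
    congr 1
    rcases i with i | i <;> refine Fin.cases ?_ (fun i => ?_) i <;> simp [pi0]

lemma pi0_powerSum (p : ℕ) (hp : 1 ≤ p) : pi0 m n (powerSum (m+1) (n+1) p) = powerSum m n p := by
  have : p ≠ 0 := by omega
  simp [powerSum_eq, pi0, Fin.sum_univ_succ, this]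

lemma cons_comp_perm {k : ℕ} (u : Fin k → ℂ) (σ : Equiv.Perm (Fin k)) :
    (Fin.cons 0 (u ∘ σ) : Fin (k+1) → ℂ) =
      (Fin.cons 0 u : Fin (k+1) → ℂ) ∘ Equiv.Perm.decomposeFin.symm (0, σ) := by
  ext i
  refine Fin.cases ?_ (fun i => ?_) i <;> simp

lemma SS.pi0 {f : MvPolynomial (Fin (m+1) ⊕ Fin (n+1)) ℂ} (hf : SS f) : SS (pi0 m n f) where
  symm σ τ u v := by
    rw [eval_pi0, eval_pi0, cons_comp_perm, cons_comp_perm, hf.symm]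
  canc i j u v t t' := by
    rw [eval_pi0, eval_pi0]
    simp_rw [Fin.cons_update]
    exact hf.canc _ _ _ _ _ _

lemma eval_aeval {ι κ : Type*} (g : ι → MvPolynomial κ ℂ) (x : κ → ℂ) (f : MvPolynomial ι ℂ) :
    eval x (aeval g f) = eval (fun k => eval x (g k)) f := by
  induction f using MvPolynomial.induction_on with
  | C a => simp
  | add p q hp hq => rw [map_add, map_add, map_add, hp, hq]
  | mul_X p i hp => rw [map_mul, map_mul, map_mul, hp, aeval_X, eval_X]

lemma dvd_of_vanish (f : MvPolynomial (Fin m ⊕ Fin n) ℂ) (i : Fin m) (j : Fin n)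
    (h : ∀ x : Fin m ⊕ Fin n → ℂ, x (Sum.inr j) = - x (Sum.inl i) → eval x f = 0) :
    (-X (Sum.inr j) - X (Sum.inl i)) ∣ f := by
  classical
  let g : Fin m ⊕ Fin n → MvPolynomial (Fin m ⊕ Fin n) ℂ :=
    Function.update X (Sum.inr j) (-X (Sum.inl i))
  have h0 : aeval g f = 0 := by
    apply MvPolynomial.funext
    intro x
    rw [map_zero]
    rw [eval_aeval]
    apply h
    simp [g]
  rw [← Ideal.mem_span_singleton, ← Ideal.Quotient.eq_zero_iff_mem]
  set I := Ideal.span {(-X (Sum.inr j) - X (Sum.inl i) : MvPolynomial (Fin m ⊕ Fin n) ℂ)}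
  have e : (Ideal.Quotient.mkₐ ℂ I) = (Ideal.Quotient.mkₐ ℂ I).comp (aeval g) := by
    ext k
    simp only [AlgHom.comp_apply, aeval_X, g]
    by_cases hk : k = Sum.inr j
    · subst hk
      simp only [Function.update_self]
      change Ideal.Quotient.mk I _ = Ideal.Quotient.mk I _
      rw [eq_comm, Ideal.Quotient.eq]
      apply Ideal.mem_span_singleton.2
      exact ⟨1, by ring⟩
    · rw [Function.update_of_ne hk]
  have := congrArg (fun φ => φ f) e
  simp only [AlgHom.comp_apply, h0, map_zero] at this
  exact this

lemma irred_lin (i : Fin m) (j : Fin n) :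
    Irreducible (-X (Sum.inr j) - X (Sum.inl i) : MvPolynomial (Fin m ⊕ Fin n) ℂ) := by
  classical
  let c : Fin m ⊕ Fin n →₀ ℂ := -Finsupp.single (Sum.inr j) 1 - Finsupp.single (Sum.inl i) 1
  have hc : c (Sum.inr j) = -1 := by simp [c]
  have := irreducible_sumSMulX c ⟨Sum.inr j, by simp [hc]⟩ (fun r hr => by
    have := hr (Sum.inr j)
    rw [hc] at this
    exact isUnit_of_dvd_unit this (by simp))
  convert this using 1
  simp [sumSMulX, c, map_sub, map_neg]

lemma Del_dvd (f : MvPolynomial (Fin m ⊕ Fin n) ℂ)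
    (h : ∀ i j, (-X (Sum.inr j) - X (Sum.inl i)) ∣ f) : Del m n ∣ f := by
  classical
  have : Del m n = ∏ p : Fin n × Fin m, (-X (Sum.inr p.1) - X (Sum.inl p.2)) := by
    rw [Fintype.prod_prod_type, Del]
  rw [this]
  apply Fintype.prod_dvd_of_isRelPrime
  · rintro ⟨j, i⟩ ⟨l, k⟩ hne
    change IsRelPrime _ _
    rw [(irred_lin i j).isRelPrime_iff_not_dvd]
    rintro ⟨q, hq⟩
    have e := congrArg (eval (Sum.elim (fun x => if x = i then 1 else 5)
      (fun x => if x = j then -1 else 5) : Fin m ⊕ Fin n → ℂ)) hq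
    simp only [map_mul, map_sub, map_neg, eval_X, Sum.elim_inl, Sum.elim_inr, if_true] at e
    by_cases h1 : k = i <;> by_cases h2 : l = j
    · subst h1 h2; exact hne rfl
    all_goals norm_num [h1, h2] at e
  · rintro ⟨j, i⟩; exact h i j

lemma rename_Del (σ : Equiv.Perm (Fin m)) (τ : Equiv.Perm (Fin n)) :
    rename (Sum.map σ τ) (Del m n) = Del m n := by
  simp only [Del, map_prod, map_sub, map_neg, rename_X, Sum.map_inl, Sum.map_inr]
  rw [Equiv.prod_comp τ (fun j => ∏ i, (-X (Sum.inr j) - X (Sum.inl (σ i)) :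
    MvPolynomial (Fin m ⊕ Fin n) ℂ))]
  refine Finset.prod_congr rfl fun j _ => ?_
  rw [Equiv.prod_comp σ (fun i => (-X (Sum.inr j) - X (Sum.inl i) :
    MvPolynomial (Fin m ⊕ Fin n) ℂ))]

lemma Del_ne_zero : Del m n ≠ 0 := by
  refine Finset.prod_ne_zero_iff.2 fun j _ => Finset.prod_ne_zero_iff.2 fun i _ => ?_
  exact (irred_lin i j).ne_zero

lemma mem_of_Del_dvd {f : MvPolynomial (Fin m ⊕ Fin n) ℂ} (hf : SS f) (h : Del m n ∣ f) :
    f ∈ PA m n := by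
  obtain ⟨q, rfl⟩ := h
  apply Del_mul_mem
  intro σ τ
  have := hf.rename_eq σ τ
  rw [map_mul, rename_Del] at this
  exact mul_left_cancel₀ Del_ne_zero this

lemma vanish {f : MvPolynomial (Fin (m+1) ⊕ Fin (n+1)) ℂ} (hf : SS f) (h0 : SSym.pi0 m n f = 0)
    (i : Fin (m+1)) (j : Fin (n+1)) (x : Fin (m+1) ⊕ Fin (n+1) → ℂ)
    (hx : x (Sum.inr j) = - x (Sum.inl i)) : eval x f = 0 := by
  obtain ⟨u, v, rfl⟩ : ∃ u v, x = Sum.elim u v := ⟨_, _, (Sum.elim_comp_inl_inr x).symm⟩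
  simp only [Sum.elim_inl, Sum.elim_inr] at hx
  have h1 := hf.canc i j u v (u i) 0
  rw [← hx, Function.update_eq_self, Function.update_eq_self] at h1
  rw [h1, ← hf.symm (Equiv.swap i 0) (Equiv.swap j 0)]
  have key : ∀ {k : ℕ} (w : Fin (k+1) → ℂ) (i : Fin (k+1)), w i = 0 →
      w ∘ (Equiv.swap i 0) = Fin.cons 0 (Fin.tail (w ∘ (Equiv.swap i 0))) := by
    intro k w i hw
    rw [← Fin.cons_self_tail (w ∘ (Equiv.swap i 0))]
    simp [hw]
  rw [key _ i (by simp), key _ j (by simp), ← eval_pi0, h0, map_zero]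

lemma mem_of_SS : ∀ (m n : ℕ) (f : MvPolynomial (Fin m ⊕ Fin n) ℂ), SS f → f ∈ PA m n
  | 0, n, f, hf => mem_of_Del_dvd hf (by simp [Del])
  | m+1, 0, f, hf => mem_of_Del_dvd hf (by simp [Del])
  | m+1, n+1, f, hf => by
    have ih := mem_of_SS m n _ hf.pi0
    have hle : PA m n ≤ (PA (m+1) (n+1)).map (SSym.pi0 m n) := by
      refine Algebra.adjoin_le ?_
      rintro _ ⟨p, hp, rfl⟩
      exact ⟨_, Algebra.subset_adjoin ⟨p, hp, rfl⟩, pi0_powerSum p hp⟩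
    obtain ⟨g, hg, e⟩ := hle ih
    have hs : SS (f - g) := hf.sub (SS_of_mem hg)
    have h0 : SSym.pi0 m n (f - g) = 0 := by
      rw [map_sub, sub_eq_zero]; exact e.symm
    have := mem_of_Del_dvd hs (Del_dvd _ fun i j => dvd_of_vanish _ i j (vanish hs h0 i j))
    simpa using Subalgebra.add_mem _ this hg

lemma eval_substVar (m n : ℕ) (hm : 1 ≤ m) (hn : 1 ≤ n) (f : MvPolynomial (Fin m ⊕ Fin n) ℂ)
    (u : Fin m → ℂ) (v : Fin n → ℂ) (t : ℂ) :
    eval (Sum.elim u v) (aeval (substVar m n t) f) =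
      eval (Sum.elim (Function.update u ⟨m - 1, by omega⟩ t)
        (Function.update v ⟨n - 1, by omega⟩ (-t))) f := by
  rw [eval_aeval]
  congr 2
  ext k
  rcases k with k | k
  · simp only [substVar, Sum.elim_inl, Function.update_apply, Fin.ext_iff]
    split_ifs <;> simp
  · simp only [substVar, Sum.elim_inr, Function.update_apply, Fin.ext_iff]
    split_ifs <;> simp

lemma SS_iff (m n : ℕ) (hm : 1 ≤ m) (hn : 1 ≤ n) (f : MvPolynomial (Fin m ⊕ Fin n) ℂ) :
    SS f ↔ ((∀ σ : Equiv.Perm (Fin m), rename (Sum.map σ id) f = f) ∧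
     (∀ τ : Equiv.Perm (Fin n), rename (Sum.map id τ) f = f) ∧
     (∀ t t' : ℂ, aeval (substVar m n t) f = aeval (substVar m n t') f)) := by
  constructor
  · intro h
    refine ⟨fun σ => h.rename_eq σ 1, fun τ => h.rename_eq 1 τ, fun t t' => ?_⟩
    apply MvPolynomial.funext
    intro x
    rw [← Sum.elim_comp_inl_inr x, eval_substVar m n hm hn, eval_substVar m n hm hn]
    exact h.canc _ _ _ _ _ _
  · rintro ⟨h1, h2, h3⟩
    have hs : ∀ (σ : Equiv.Perm (Fin m)) (τ : Equiv.Perm (Fin n)) (u : Fin m → ℂ) (v : Fin n → ℂ),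
        eval (Sum.elim (u ∘ σ) (v ∘ τ)) f = eval (Sum.elim u v) f := by
      intro σ τ u v
      conv_rhs => rw [← h1 σ, eval_rename, ← h2 τ, eval_rename]
      congr 2
      ext k
      rcases k with k | k <;> simp
    refine ⟨hs, fun i j u v t t' => ?_⟩
    have key : ∀ t, eval (Sum.elim (Function.update u i t) (Function.update v j (-t))) f =
        eval (Sum.elim (u ∘ Equiv.swap i ⟨m - 1, by omega⟩) (v ∘ Equiv.swap j ⟨n - 1, by omega⟩))
          (aeval (substVar m n t) f) := by
      intro t
      rw [eval_substVar m n hm hn, ← hs (Equiv.swap i ⟨m - 1, by omega⟩)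
        (Equiv.swap j ⟨n - 1, by omega⟩)]
      rw [Function.update_comp_equiv, Function.update_comp_equiv, Equiv.symm_swap, Equiv.symm_swap,
        Equiv.swap_apply_left, Equiv.swap_apply_left]
    rw [key, key, h3 t t']

end SSym

/-- A polynomial in `ℂ[u₁, …, u_m, v₁, …, v_n]` is supersymmetric (invariant
under permutations of the `u`'s, invariant under permutations of the `v`'s, and
the substitution `u_m = t`, `v_n = −t` yields a result independent of `t`)
if and only if it lies in the ℂ-subalgebra generated by the power sums `s_p`, `p ≥ 1`. -/
theorem supersymmetric_iff_mem_adjoin_powerSums (m n : ℕ) (hm : 1 ≤ m) (hn : 1 ≤ n)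
    (f : MvPolynomial (Fin m ⊕ Fin n) ℂ) :
    ((∀ σ : Equiv.Perm (Fin m), rename (Sum.map σ id) f = f) ∧
     (∀ τ : Equiv.Perm (Fin n), rename (Sum.map id τ) f = f) ∧
     (∀ t t' : ℂ, aeval (substVar m n t) f = aeval (substVar m n t') f)) ↔
    f ∈ Algebra.adjoin ℂ
      {g : MvPolynomial (Fin m ⊕ Fin n) ℂ | ∃ p : ℕ, 1 ≤ p ∧ g = powerSum m n p} := by
  rw [← SSym.SS_iff m n hm hn]
  exact ⟨SSym.mem_of_SS m n f, SSym.SS_of_mem⟩
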